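/- arXiv:1204.3161 — 2 statements merged into one kernel-verified Lean document; each statement's English description precedes it below -/
import Mathlib

section
/- For d = 6, every integer t with 4 ≤ t ≤ 6 is a typical rank for real bivariate homogeneous forms of degree d; for d = 7, every integer t with 4 ≤ t ≤ 7 is a typical rank for real bivariate homogeneous forms of degree d. In other words, the Comon–Ottaviani conjecture (that every integer t with ⌊(d+2)/2⌋ ≤ t ≤ d is a typical rank) holds for d = 6 and d = 7. -/
/-!
We model the space `K[x,y]_d` of degree-`d` homogeneous bivariate forms over `K`
by its coefficient vectors `Fin (d+1) → K`, where `f i` is the coefficient of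
`x^i * y^(d-i)`.  A linear form `p*x + q*y ∈ K[x,y]_1` is modeled by the pair
`(p, q) : K × K`; `powVec d (p,q)` is the coefficient vector of `(p*x + q*y)^d`.
-/

/-- Coefficient vector of `(p*x + q*y)^d` in the basis `x^i y^(d-i)`. -/
noncomputable def powVec {K : Type*} [CommRing K] (d : ℕ) (L : K × K) :
    Fin (d + 1) → K :=
  fun i => (d.choose (i : ℕ) : K) * L.1 ^ (i : ℕ) * L.2 ^ (d - (i : ℕ))

/-- The rank over `K` of a degree-`d` form: the minimal `r` such that
`f = ∑_{i=1}^r c_i L_i^d` with `c_i ∈ K` and linear forms `L_i ∈ K[x,y]_1`. -/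
noncomputable def rankK (K : Type*) [CommRing K] (d : ℕ) (f : Fin (d + 1) → K) : ℕ :=
  sInf {r : ℕ | ∃ (c : Fin r → K) (L : Fin r → K × K), f = ∑ i, c i • powVec d (L i)}

/-- The real rank `Rsr` of a real binary form of degree `d`. -/
noncomputable def Rsr (d : ℕ) (f : Fin (d + 1) → ℝ) : ℕ := rankK ℝ d f

/-- The complex rank `Csr` of a complex binary form of degree `d`. -/
noncomputable def Csr (d : ℕ) (f : Fin (d + 1) → ℂ) : ℕ := rankK ℂ d f

/-- A real form regarded as a complex form (coefficientwise inclusion `ℝ ↪ ℂ`). -/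
noncomputable def complexify {d : ℕ} (f : Fin (d + 1) → ℝ) : Fin (d + 1) → ℂ :=
  fun i => (f i : ℂ)

/-- `t` is a typical rank in degree `d`: there is a nonempty euclidean-open set of
real degree-`d` forms on which the real rank is constantly `t`. -/
def IsTypicalRank (d t : ℕ) : Prop :=
  ∃ V : Set (Fin (d + 1) → ℝ), IsOpen V ∧ V.Nonempty ∧ ∀ f ∈ V, Rsr d f = t

/-- Two linear forms (modeled as coefficient pairs) are proportional if one is a
scalar multiple of the other. -/
def AreProportional {K : Type*} [CommRing K] (u v : K × K) : Prop :=
  ∃ t : K, v = t • u ∨ u = t • v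

open Polynomial Filter Topology

/-- The apolar pairing of the degree-`d` form `f` with a polynomial `g` of degree at most `d`,
normalized so that pairing with `(p x + q y) ^ d` evaluates the homogenization of `g`
at `(p, q)`. -/
noncomputable def apolarPairing {d : ℕ} (f : Fin (d + 1) → ℝ) (g : ℝ[X]) : ℝ :=
  ∑ i : Fin (d + 1), g.coeff i * (f i / d.choose i)

/-- The dehomogenized form vanishing at each of the given linear forms. -/
noncomputable def vanishingPoly {n : ℕ} (L : Fin n → ℝ × ℝ) : ℝ[X] :=
  ∏ k, (C (L k).2 * X - C (L k).1)

lemma apolarPairing_sum {d n : ℕ} (c : Fin n → ℝ) (v : Fin n → Fin (d + 1) → ℝ) (g : ℝ[X]) :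
    apolarPairing (∑ k, c k • v k) g = ∑ k, c k * apolarPairing (v k) g := by
  simp only [apolarPairing, Finset.sum_apply, Pi.smul_apply, smul_eq_mul, Finset.mul_sum,
    Finset.sum_div]
  rw [Finset.sum_comm]
  refine Finset.sum_congr rfl fun k _ => Finset.sum_congr rfl fun i _ => ?_
  ring

lemma apolarPairing_powVec (d : ℕ) (p q : ℝ) (g : ℝ[X]) :
    apolarPairing (powVec d (p, q)) g =
      ∑ i ∈ Finset.range (d + 1), g.coeff i * (p ^ i * q ^ (d - i)) := by
  rw [apolarPairing, ← Fin.sum_univ_eq_sum_range (fun i => g.coeff i * (p ^ i * q ^ (d - i)))]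
  refine Finset.sum_congr rfl fun i _ => ?_
  have : (d.choose i : ℝ) ≠ 0 := by
    exact_mod_cast (Nat.choose_pos (Nat.lt_succ_iff.mp i.2)).ne'
  simp only [powVec]
  field_simp

lemma apolarPairing_powVec_one {d : ℕ} (p : ℝ) {g : ℝ[X]} (hg : g.natDegree ≤ d) :
    apolarPairing (powVec d (p, 1)) g = g.eval p := by
  rw [apolarPairing_powVec, eval_eq_sum_range' (Nat.lt_succ_of_le hg)]
  simp

lemma apolarPairing_powVec_eq_zero {d : ℕ} (L : ℝ × ℝ) {u : ℝ[X]} (hu : u.natDegree < d) :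
    apolarPairing (powVec d L) ((C L.2 * X - C L.1) * u) = 0 := by
  obtain ⟨p, q⟩ := L
  have hc : u.coeff d = 0 := coeff_eq_zero_of_natDegree_lt hu
  rw [apolarPairing_powVec]
  have key : ∀ n ≤ d, ∑ i ∈ Finset.range (n + 1),
      ((C q * X - C p) * u).coeff i * (p ^ i * q ^ (d - i)) =
        - u.coeff n * (p ^ (n + 1) * q ^ (d - n)) := by
    intro n
    induction n with
    | zero =>
      intro _
      simp [sub_mul, mul_assoc]
      ring
    | succ n ih =>
      intro hn
      rw [Finset.sum_range_succ, ih (by omega)]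
      have h1 : ((C q * X - C p) * u).coeff (n + 1) = q * u.coeff n - p * u.coeff (n + 1) := by
        rw [sub_mul, mul_assoc, coeff_sub, coeff_C_mul, coeff_C_mul, coeff_X_mul]
      have h2 : d - n = (d - (n + 1)) + 1 := by omega
      rw [h1, h2]
      ring
  simpa [hc] using key d le_rfl

lemma natDegree_vanishingPoly_factor_le (a : ℝ × ℝ) : (C a.2 * X - C a.1).natDegree ≤ 1 := by
  compute_degree

lemma natDegree_vanishingPoly_le {n : ℕ} (L : Fin n → ℝ × ℝ) :
    (vanishingPoly L).natDegree ≤ n := by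
  refine (natDegree_prod_le _ _).trans ?_
  calc _ ≤ ∑ _k : Fin n, 1 :=
        Finset.sum_le_sum fun k _ => natDegree_vanishingPoly_factor_le (L k)
    _ = n := by simp

lemma apolarPairing_sum_powVec_mul_vanishingPoly {d n : ℕ} (c : Fin n → ℝ) (L : Fin n → ℝ × ℝ)
    {g : ℝ[X]} (hg : n + g.natDegree ≤ d) :
    apolarPairing (∑ k, c k • powVec d (L k)) (vanishingPoly L * g) = 0 := by
  rw [apolarPairing_sum]
  refine Finset.sum_eq_zero fun k _ => ?_
  rw [vanishingPoly, ← Finset.mul_prod_erase _ _ (Finset.mem_univ k), mul_assoc,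
    apolarPairing_powVec_eq_zero, mul_zero]
  have h1 : (∏ j ∈ Finset.univ.erase k, (C (L j).2 * X - C (L j).1)).natDegree ≤ n - 1 := by
    refine (natDegree_prod_le _ _).trans ?_
    calc _ ≤ ∑ _j ∈ Finset.univ.erase k, 1 :=
          Finset.sum_le_sum fun j _ => natDegree_vanishingPoly_factor_le (L j)
      _ = n - 1 := by simp
  have := k.pos
  have := natDegree_mul_le (p := ∏ j ∈ Finset.univ.erase k, (C (L j).2 * X - C (L j).1)) (q := g)
  omega

lemma continuous_coeff_prod {ι : Type*} {n : ℕ} (s : Finset (Fin n)) (i : ℕ)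
    [TopologicalSpace ι] {L : ι → Fin n → ℝ × ℝ} (hL : Continuous L) :
    Continuous fun z => (∏ k ∈ s, (C (L z k).2 * X - C (L z k).1)).coeff i := by
  induction s using Finset.cons_induction generalizing i with
  | empty => simpa using continuous_const
  | cons a s ha ih =>
    have hsucc (z : ι) : (∏ k ∈ Finset.cons a s ha, (C (L z k).2 * X - C (L z k).1)) =
        C (L z a).2 * (X * ∏ k ∈ s, (C (L z k).2 * X - C (L z k).1)) -
          C (L z a).1 * ∏ k ∈ s, (C (L z k).2 * X - C (L z k).1) := by
      rw [Finset.prod_cons]; ring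
    simp only [hsucc, coeff_sub, coeff_C_mul]
    cases i with
    | zero =>
      simp only [coeff_X_mul_zero]
      have := ih 0
      fun_prop
    | succ i =>
      simp only [coeff_X_mul]
      have := ih i
      have := ih (i + 1)
      fun_prop

lemma continuous_apolarPairing_vanishingPoly (d n m : ℕ) :
    Continuous fun z : (Fin (d + 1) → ℝ) × (Fin n → ℝ × ℝ) =>
      apolarPairing z.1 (vanishingPoly z.2 * X ^ m) := by
  simp only [apolarPairing, coeff_mul_X_pow']
  refine continuous_finsetSum _ fun i _ => Continuous.mul ?_ (by fun_prop)
  split_ifs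
  · exact continuous_coeff_prod _ _ continuous_snd
  · exact continuous_const

lemma exists_smul_powVec_eq {d : ℕ} (hd : d ≠ 0) (c : ℝ) (L : ℝ × ℝ) :
    ∃ (c' : ℝ) (L' : ℝ × ℝ), L' ∈ Metric.sphere (0 : ℝ × ℝ) 1 ∧
      c • powVec d L = c' • powVec d L' := by
  rcases eq_or_ne L 0 with rfl | hL
  · refine ⟨0, (1, 0), by simp [Prod.norm_def], ?_⟩
    ext i
    rcases eq_or_ne (i : ℕ) 0 with hi | hi <;> simp [powVec, hi, hd]
  · refine ⟨c * ‖L‖ ^ d, ‖L‖⁻¹ • L, by simp [norm_smul, hL], ?_⟩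
    ext i
    have hi : d = i + (d - i) := by have := i.2; omega
    have hL' : ‖L‖ ≠ 0 := norm_ne_zero_iff.mpr hL
    simp only [powVec, Pi.smul_apply, smul_eq_mul, Prod.smul_fst, Prod.smul_snd, mul_pow,
      inv_pow]
    have : ‖L‖ ^ d = ‖L‖ ^ (i : ℕ) * ‖L‖ ^ (d - i) := by rw [← pow_add, ← hi]
    rw [this]
    field_simp

/-- If no product of `n` real linear forms is apolar to `f₀`, then the forms near `f₀` are not
sums of `n` powers. -/
lemma eventually_ne_sum_powVec {d n : ℕ} (hn : n < d) (f₀ : Fin (d + 1) → ℝ)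
    (h : ∀ L : Fin n → ℝ × ℝ, (∀ k, L k ∈ Metric.sphere (0 : ℝ × ℝ) 1) →
      apolarPairing f₀ (vanishingPoly L * X ^ 0) = 0 →
      apolarPairing f₀ (vanishingPoly L * X ^ 1) ≠ 0) :
    ∀ᶠ f in 𝓝 f₀, ∀ (c : Fin n → ℝ) (L : Fin n → ℝ × ℝ), f ≠ ∑ k, c k • powVec d (L k) := by
  have hK : IsCompact (Set.univ.pi fun _ : Fin n => Metric.sphere (0 : ℝ × ℝ) 1) :=
    isCompact_univ_pi fun _ => isCompact_sphere _ _
  have := hK.eventually_forall_of_forall_eventually (x₀ := f₀)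
    (P := fun f L => ¬ (apolarPairing f (vanishingPoly L * X ^ 0) = 0 ∧
      apolarPairing f (vanishingPoly L * X ^ 1) = 0)) ?_
  · filter_upwards [this] with f hf c L hfL
    choose c' L' hL' hc' using fun k => exists_smul_powVec_eq (d := d) (by omega) (c k) (L k)
    simp only [hc'] at hfL
    subst hfL
    exact hf L' (fun k _ => hL' k)
      ⟨apolarPairing_sum_powVec_mul_vanishingPoly _ _ (by simpa using hn.le),
        apolarPairing_sum_powVec_mul_vanishingPoly _ _ (by simpa using hn)⟩
  · intro L hL
    refine IsOpen.mem_nhds (IsClosed.isOpen_compl (s := {z : (Fin (d + 1) → ℝ) × _ |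
      apolarPairing z.1 (vanishingPoly z.2 * X ^ 0) = 0 ∧
      apolarPairing z.1 (vanishingPoly z.2 * X ^ 1) = 0}) (self := ?_)) ?_
    · exact (isClosed_eq (continuous_apolarPairing_vanishingPoly d n 0) continuous_const).inter
        (isClosed_eq (continuous_apolarPairing_vanishingPoly d n 1) continuous_const)
    · exact fun hz => h L (fun k => hL k trivial) hz.1 hz.2

lemma not_X_sq_add_one_dvd_vanishingPoly {n : ℕ} {L : Fin n → ℝ × ℝ} (hL : ∀ k, L k ≠ 0) :
    ¬ (X ^ 2 + 1 : ℝ[X]) ∣ vanishingPoly L := by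
  rintro ⟨u, hu⟩
  have h := congrArg (aeval Complex.I) hu
  simp only [vanishingPoly, map_prod, map_mul, map_add, map_sub, map_pow, aeval_X, aeval_C,
    map_one, Complex.I_sq, neg_add_cancel, zero_mul, Finset.prod_eq_zero_iff] at h
  obtain ⟨k, -, hk⟩ := h
  have h1 := congrArg Complex.re hk
  have h2 := congrArg Complex.im hk
  simp at h1 h2
  exact hL k (Prod.ext h1 h2)

/-- Nonzero weights on `r` nodes annihilating every multiple of `X ^ 2 + 1` of degree at
most `r`. -/
lemma exists_weights {r : ℕ} {x : Fin r → ℝ} (hx : Function.Injective x) :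
    ∃ c : Fin r → ℝ, (∀ j, c j ≠ 0) ∧
      ∀ p : ℝ[X], p.natDegree ≤ r → X ^ 2 + 1 ∣ p → ∑ j, c j * p.eval (x j) = 0 := by
  have hpos (j : Fin r) : x j ^ 2 + 1 ≠ 0 := by positivity
  have hprod (j : Fin r) : ∏ i ∈ Finset.univ.erase j, (x j - x i) ≠ 0 :=
    Finset.prod_ne_zero_iff.mpr fun i hi =>
      sub_ne_zero.mpr fun h => (Finset.ne_of_mem_erase hi) (hx h).symm
  refine ⟨fun j => ((x j ^ 2 + 1) * ∏ i ∈ Finset.univ.erase j, (x j - x i))⁻¹,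
    fun j => inv_ne_zero (mul_ne_zero (hpos j) (hprod j)), ?_⟩
  rintro p hp ⟨q, rfl⟩
  rcases eq_or_ne q 0 with rfl | hq
  · simp
  have hm : (X ^ 2 + 1 : ℝ[X]).natDegree = 2 := by compute_degree!
  have hm0 : (X ^ 2 + 1 : ℝ[X]) ≠ 0 := fun h => by simp [h] at hm
  rw [natDegree_mul hm0 hq, hm] at hp
  have hdeg : q.degree < (Finset.univ : Finset (Fin r)).card := by
    rw [Finset.card_univ, Fintype.card_fin]
    exact (natDegree_lt_iff_degree_lt hq).mp (by omega)
  have := Lagrange.coeff_eq_sum (s := Finset.univ) hx.injOn hdeg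
  rw [coeff_eq_zero_of_natDegree_lt (by simp; omega)] at this
  rw [this]
  refine Finset.sum_congr rfl fun j _ => ?_
  simp only [eval_mul, eval_add, eval_pow, eval_X, eval_one]
  have := hpos j
  have := hprod j
  field_simp

lemma X_sq_add_one_dvd {r : ℕ} (hr : 2 ≤ r) {x c : Fin r → ℝ} (hx : Function.Injective x)
    (hc : ∀ j, c j ≠ 0)
    (hann : ∀ p : ℝ[X], p.natDegree ≤ r → X ^ 2 + 1 ∣ p → ∑ j, c j * p.eval (x j) = 0)
    {h : ℝ[X]} (hdeg : h.natDegree < r) (h0 : ∑ j, c j * h.eval (x j) = 0)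
    (h1 : ∑ j, c j * (h * X).eval (x j) = 0) : X ^ 2 + 1 ∣ h := by
  have hm : (X ^ 2 + 1 : ℝ[X]).natDegree = 2 := by compute_degree!
  have hmonic : (X ^ 2 + 1 : ℝ[X]).Monic := by monicity!
  have hne : (X ^ 2 + 1 : ℝ[X]) ≠ 1 := fun h => by simp [h] at hm
  have hrem (g : ℝ[X]) : ∃ a b : ℝ, X ^ 2 + 1 ∣ g - (C a * X + C b) := by
    obtain ⟨a, b, hab⟩ := exists_eq_X_add_C_of_natDegree_le_one
      (p := g %ₘ (X ^ 2 + 1)) (by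
        have := natDegree_modByMonic_lt g hmonic hne
        omega)
    refine ⟨a, b, ?_⟩
    rw [← hab]
    exact ⟨g /ₘ (X ^ 2 + 1), by linear_combination -modByMonic_add_div g (X ^ 2 + 1)⟩
  have hlin (g : ℝ[X]) (a b : ℝ) (hg : g.natDegree ≤ r) (hd : X ^ 2 + 1 ∣ g - (C a * X + C b)) :
      ∑ j, c j * g.eval (x j) = a * ∑ j, c j * x j + b * ∑ j, c j := by
    have := hann _ ((natDegree_sub_le_of_le hg (natDegree_linear_le (a := a) (b := b))).trans
      (max_le le_rfl (by omega))) hd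
    simp only [eval_sub, eval_add, eval_mul, eval_C, eval_X, mul_sub, Finset.sum_sub_distrib,
      sub_eq_zero] at this
    rw [this, Finset.mul_sum, Finset.mul_sum, ← Finset.sum_add_distrib]
    exact Finset.sum_congr rfl fun j _ => by ring
  obtain ⟨a, b, hab⟩ := hrem h
  rw [hlin h a b hdeg.le hab] at h0
  rw [hlin (h * X) b (-a) ((natDegree_mul_le).trans (by simpa using hdeg)) (by
    have := (hab.mul_right X).add (dvd_mul_right (X ^ 2 + 1) (C a))
    convert this using 1
    simp only [map_neg]
    ring)] at h1
  by_cases hz : a = 0 ∧ b = 0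
  · simpa [hz.1, hz.2] using hab
  exfalso
  have hsq : a ^ 2 + b ^ 2 ≠ 0 := fun h => hz ⟨by nlinarith [sq_nonneg a, sq_nonneg b],
    by nlinarith [sq_nonneg a, sq_nonneg b]⟩
  have hX : ∑ j, c j * x j = 0 :=
    (mul_eq_zero_iff_left hsq).mp (by linear_combination a * h0 + b * h1)
  have hone : ∑ j, c j = 0 :=
    (mul_eq_zero_iff_left hsq).mp (by linear_combination b * h0 - a * h1)
  let j₀ : Fin r := ⟨0, by omega⟩
  set B := Lagrange.basis Finset.univ x j₀ with hB
  obtain ⟨a', b', hab'⟩ := hrem B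
  have hBdeg : B.natDegree ≤ r := by
    rw [hB, Lagrange.natDegree_basis hx.injOn (Finset.mem_univ _)]
    simp
  have hsum := hlin B a' b' hBdeg hab'
  rw [hX, hone, Finset.sum_eq_single j₀] at hsum
  · rw [hB, Lagrange.eval_basis_self hx.injOn (Finset.mem_univ _)] at hsum
    exact hc j₀ (by simpa using hsum)
  · intro j _ hj
    rw [hB, Lagrange.eval_basis_of_ne hj.symm (Finset.mem_univ _), mul_zero]
  · simp

lemma eq_zero_of_double_roots {r : ℕ} {x : Fin r → ℝ} (hx : Function.Injective x) {g : ℝ[X]}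
    (hdeg : g.natDegree < 2 * r) (h0 : ∀ j, g.eval (x j) = 0)
    (h1 : ∀ j, (derivative g).eval (x j) = 0) : g = 0 := by
  by_contra hg
  have hdvd : ∏ j, (X - C (x j)) ^ 2 ∣ g := by
    refine Finset.prod_dvd_of_coprime ?_ fun j _ => ?_
    · intro i _ j _ hij
      exact (pairwise_coprime_X_sub_C hx hij).pow
    · exact (le_rootMultiplicity_iff hg).mp
        ((one_lt_rootMultiplicity_iff_isRoot hg).mpr ⟨h0 j, h1 j⟩)
  have := natDegree_le_of_dvd hdvd hg
  rw [natDegree_prod_of_monic _ _ fun j _ => (monic_X_sub_C _).pow 2] at this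
  simp at this
  omega

/-- Terracini's lemma for the rational normal curve: generic sums of `r` powers fill a
neighbourhood once `d < 2 * r`. -/
lemma eventually_exists_eq_sum_powVec {d r : ℕ} (hdr : d < 2 * r) {x c : Fin r → ℝ}
    (hx : Function.Injective x) (hc : ∀ j, c j ≠ 0) :
    ∀ᶠ f in 𝓝 (∑ j, c j • powVec d (x j, 1)),
      ∃ (c : Fin r → ℝ) (L : Fin r → ℝ × ℝ), f = ∑ j, c j • powVec d (L j) := by
  let Φ : (Fin r → ℝ) × (Fin r → ℝ) → Fin (d + 1) → ℝ :=
    fun z i => ∑ j, z.1 j * ((d.choose i : ℝ) * z.2 j ^ (i : ℕ))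
  have hΦ (z : (Fin r → ℝ) × (Fin r → ℝ)) : Φ z = ∑ j, z.1 j • powVec d (z.2 j, 1) := by
    ext i
    simp [Φ, powVec]
  have hfst (j : Fin r) : HasStrictFDerivAt (fun z : (Fin r → ℝ) × (Fin r → ℝ) => z.1 j)
      ((ContinuousLinearMap.proj j).comp (ContinuousLinearMap.fst ℝ _ _)) (c, x) :=
    ContinuousLinearMap.hasStrictFDerivAt
      ((ContinuousLinearMap.proj (R := ℝ) (φ := fun _ : Fin r => ℝ) j).comp
        (ContinuousLinearMap.fst ℝ (Fin r → ℝ) (Fin r → ℝ)))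
  have hsnd (j : Fin r) : HasStrictFDerivAt (fun z : (Fin r → ℝ) × (Fin r → ℝ) => z.2 j)
      ((ContinuousLinearMap.proj j).comp (ContinuousLinearMap.snd ℝ _ _)) (c, x) :=
    ContinuousLinearMap.hasStrictFDerivAt
      ((ContinuousLinearMap.proj (R := ℝ) (φ := fun _ : Fin r => ℝ) j).comp
        (ContinuousLinearMap.snd ℝ (Fin r → ℝ) (Fin r → ℝ)))
  have hderiv : HasStrictFDerivAt Φ _ (c, x) := hasStrictFDerivAt_pi.mpr fun i =>
    HasStrictFDerivAt.fun_sum fun j (_ : j ∈ Finset.univ) =>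
      (hfst j).mul (((hsnd j).pow (i : ℕ)).const_mul (d.choose i : ℝ))
  have hsurj := hderiv.map_nhds_eq_of_surj ?_
  · rw [← hΦ (c, x), ← hsurj, eventually_map]
    exact Eventually.of_forall fun z => ⟨z.1, fun j => (z.2 j, 1), hΦ z⟩
  · by_contra htop
    obtain ⟨φ, hφ, hker⟩ := Submodule.exists_le_ker_of_lt_top _ (lt_top_iff_ne_top.mpr htop)
    refine hφ ?_
    have hφsum (v : Fin (d + 1) → ℝ) : φ v = ∑ i, v i * φ (Pi.single i 1) := by
      conv_lhs => rw [pi_eq_sum_univ' v]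
      simp
    let g : ℝ[X] := ∑ i : Fin (d + 1), C (φ (Pi.single i 1) * d.choose i) * X ^ (i : ℕ)
    have hg : g = 0 := by
      refine eq_zero_of_double_roots hx (lt_of_le_of_lt ?_ hdr) (fun j => ?_) fun j => ?_
      · refine natDegree_sum_le_of_forall_le _ _ fun i _ => ?_
        exact (natDegree_C_mul_X_pow_le _ _).trans (Nat.lt_succ_iff.mp i.2)
      · have := hker ⟨(Pi.single j 1, 0), rfl⟩
        rw [LinearMap.mem_ker, hφsum] at this
        simp [Pi.single_apply] at this
        rw [← this]
        simp [g, eval_finsetSum]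
        exact Finset.sum_congr rfl fun i _ => by ring
      · have := hker ⟨(0, Pi.single j 1), rfl⟩
        rw [LinearMap.mem_ker, hφsum] at this
        simp [Pi.single_apply] at this
        refine (mul_eq_zero_iff_left (hc j)).mp ?_
        rw [← this]
        simp [g, eval_finsetSum, Finset.mul_sum, derivative_X_pow]
        exact Finset.sum_congr rfl fun i _ => by ring
    refine LinearMap.ext fun v => ?_
    rw [hφsum]
    refine Finset.sum_eq_zero fun i _ => ?_
    have hi := congrArg (fun p => coeff p i) hg
    have hch : (d.choose i : ℝ) ≠ 0 := by
      exact_mod_cast (Nat.choose_pos (Nat.lt_succ_iff.mp i.2)).ne'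
    simp [g, finsetSum_coeff, -map_mul, coeff_C_mul, coeff_X_pow, Fin.val_inj, hch] at hi
    simp [hi]

lemma exists_eq_sum_powVec_mono {d m n : ℕ} (hmn : m ≤ n) {f : Fin (d + 1) → ℝ}
    (h : ∃ (c : Fin m → ℝ) (L : Fin m → ℝ × ℝ), f = ∑ i, c i • powVec d (L i)) :
    ∃ (c : Fin n → ℝ) (L : Fin n → ℝ × ℝ), f = ∑ i, c i • powVec d (L i) := by
  obtain ⟨k, rfl⟩ := Nat.exists_eq_add_of_le hmn
  obtain ⟨c, L, rfl⟩ := h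
  exact ⟨Fin.append c 0, Fin.append L 0, by simp [Fin.sum_univ_add]⟩

/-- Every rank `r` with `(d + 2) / 2 ≤ r ≤ d` is typical in degree `d`. -/
theorem isTypicalRank_of_le {d r : ℕ} (hdr : d < 2 * r) (hr : 2 ≤ r) (hrd : r ≤ d) :
    IsTypicalRank d r := by
  obtain ⟨n, rfl⟩ : ∃ n, r = n + 1 := ⟨r - 1, by omega⟩
  let x : Fin (n + 1) → ℝ := fun j => ((j : ℕ) : ℝ)
  have hx : Function.Injective x := fun i j hij => Fin.ext (by simpa [x] using hij)
  obtain ⟨c, hc, hann⟩ := exists_weights hx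
  have hpair (g : ℝ[X]) (hg : g.natDegree ≤ d) :
      apolarPairing (∑ j, c j • powVec d (x j, 1)) g = ∑ j, c j * g.eval (x j) := by
    rw [apolarPairing_sum]
    exact Finset.sum_congr rfl fun j _ => by rw [apolarPairing_powVec_one _ hg]
  have hlower := eventually_ne_sum_powVec (n := n) (by omega)
    (∑ j, c j • powVec d (x j, 1)) (fun L hL h0 h1 => by
      have hdeg := natDegree_vanishingPoly_le L
      rw [pow_zero, mul_one, hpair _ (by omega)] at h0
      rw [pow_one, hpair _ (natDegree_mul_le.trans (by rw [natDegree_X]; omega))] at h1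
      exact not_X_sq_add_one_dvd_vanishingPoly (L := L)
        (fun k => ne_zero_of_mem_unit_sphere ⟨L k, hL k⟩)
        (X_sq_add_one_dvd hr hx hc hann (by omega) h0 h1))
  obtain ⟨V, hV, hVo, hmem⟩ := eventually_nhds_iff.mp
    (hlower.and (eventually_exists_eq_sum_powVec hdr hx hc))
  refine ⟨V, hVo, ⟨_, hmem⟩, fun f hf => ?_⟩
  obtain ⟨hlow, hup⟩ := hV f hf
  refine le_antisymm (Nat.sInf_le hup) (le_csInf ⟨_, hup⟩ fun m hm => ?_)
  by_contra hlt
  obtain ⟨c', L', h⟩ := exists_eq_sum_powVec_mono (n := n) (by omega) hm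
  exact hlow c' L' h

/-- The Comon–Ottaviani conjecture holds for `d = 6` and `d = 7`: every integer
`t` with `⌊(d+2)/2⌋ = 4 ≤ t ≤ d` is a typical rank. -/
theorem comon_ottaviani_deg_six_seven :
    (∀ t : ℕ, 4 ≤ t → t ≤ 6 → IsTypicalRank 6 t) ∧
      (∀ t : ℕ, 4 ≤ t → t ≤ 7 → IsTypicalRank 7 t) :=
  ⟨fun _ h4 h6 => isTypicalRank_of_le (by omega) (by omega) h6,
    fun _ h4 h7 => isTypicalRank_of_le (by omega) (by omega) h7⟩
end

section
/- For every even integer d ≥ 6 there exist at least 3 distinct typical ranks for real bivariate homogeneous forms of degree d, and for every odd integer d ≥ 7 there exist at least 4 distinct typical ranks for real bivariate homogeneous forms of degree d. -/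
open Topology Polynomial

/-- The value on `t ^ j * ∏ k, (u k * t - v k)`, `w k = (u k, v k)`, of the functional
`g ↦ ∑ i, c i * g (x i)`. -/
noncomputable def nodalPairing {m s : ℕ} (c x : Fin m → ℝ) (w : Fin s → ℝ × ℝ) (j : ℕ) : ℝ :=
  ∑ i, c i * x i ^ j * ∏ k, ((w k).1 * x i - (w k).2)

/-- No nonzero real-rooted form of degree `n` is apolar to the degree `d` form
`∑ i, c i * (x i * X + Y) ^ d`, which has `n + 1` terms. -/
def IsRigid (d n : ℕ) (c x : Fin (n + 1) → ℝ) : Prop :=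
  ∀ w : Fin n → ℝ × ℝ, (∀ k, w k ≠ 0) → ∃ j, j + n ≤ d ∧ nodalPairing c x w j ≠ 0

/-- The form `∑ i, c i * (x i * X + Y) ^ d`. -/
noncomputable def nodalForm (d m : ℕ) (a : (Fin m → ℝ) × (Fin m → ℝ)) : Fin (d + 1) → ℝ :=
  ∑ i, a.1 i • powVec d (a.2 i, 1)

lemma continuous_nodalPairing {m s : ℕ} (j : ℕ) :
    Continuous fun a : ((Fin m → ℝ) × (Fin m → ℝ)) × (Fin s → ℝ × ℝ) =>
      nodalPairing a.1.1 a.1.2 a.2 j := by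
  unfold nodalPairing
  fun_prop

/-- Rescaling a nonzero vector of the plane to norm one. -/
noncomputable def rescale (v : ℝ × ℝ) : ℝ × ℝ := ‖v‖⁻¹ • v

lemma rescale_mem_sphere {v : ℝ × ℝ} (hv : v ≠ 0) : rescale v ∈ Metric.sphere (0 : ℝ × ℝ) 1 := by
  rw [mem_sphere_zero_iff_norm, rescale, norm_smul, norm_inv, norm_norm,
    inv_mul_cancel₀ (norm_ne_zero_iff.2 hv)]

lemma isCompact_spheres (s : ℕ) :
    IsCompact (Set.univ.pi fun _ : Fin s => Metric.sphere (0 : ℝ × ℝ) 1) :=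
  isCompact_univ_pi fun _ => isCompact_sphere _ _

lemma prod_rescale {s : ℕ} (w : Fin s → ℝ × ℝ) (t : ℝ) :
    ∏ k, ((rescale (w k)).1 * t - (rescale (w k)).2) =
      (∏ k, ‖w k‖⁻¹) * ∏ k, ((w k).1 * t - (w k).2) := by
  rw [← Finset.prod_mul_distrib]
  refine Finset.prod_congr rfl fun k _ => ?_
  simp only [rescale, Prod.smul_fst, Prod.smul_snd, smul_eq_mul]
  ring

lemma nodalPairing_rescale {m s : ℕ} (c x : Fin m → ℝ) (w : Fin s → ℝ × ℝ) (j : ℕ) :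
    nodalPairing c x (fun k => rescale (w k)) j =
      (∏ k, ‖w k‖⁻¹) * nodalPairing c x w j := by
  simp only [nodalPairing, prod_rescale, Finset.mul_sum]
  exact Finset.sum_congr rfl fun i _ => by ring

lemma isRigid_of_sphere {d n : ℕ} {c x : Fin (n + 1) → ℝ}
    (h : ∀ w ∈ Set.univ.pi fun _ : Fin n => Metric.sphere (0 : ℝ × ℝ) 1,
      ∃ j, j + n ≤ d ∧ nodalPairing c x w j ≠ 0) : IsRigid d n c x := by
  intro w hw
  obtain ⟨j, hj, hne⟩ := h _ fun k _ => rescale_mem_sphere (hw k)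
  rw [nodalPairing_rescale] at hne
  exact ⟨j, hj, right_ne_zero_of_mul hne⟩

lemma ne_zero_of_mem_spheres {s : ℕ} {w : Fin s → ℝ × ℝ}
    (hw : w ∈ Set.univ.pi fun _ : Fin s => Metric.sphere (0 : ℝ × ℝ) 1) (k : Fin s) :
    w k ≠ 0 :=
  ne_zero_of_mem_unit_sphere (⟨w k, hw k trivial⟩ : Metric.sphere (0 : ℝ × ℝ) 1)

lemma IsRigid.eventually {d n : ℕ} {c x : Fin (n + 1) → ℝ} (h : IsRigid d n c x) :
    ∀ᶠ a in 𝓝 (c, x), IsRigid d n a.1 a.2 := by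
  have key := (isCompact_spheres n).eventually_forall_of_forall_eventually (x₀ := (c, x))
    (P := fun a w => ∃ j, j + n ≤ d ∧ nodalPairing a.1 a.2 w j ≠ 0) fun w hw => by
      obtain ⟨j, hj, hne⟩ := h w (ne_zero_of_mem_spheres hw)
      exact ((continuous_nodalPairing j).continuousAt.eventually_ne hne).mono
        fun z hz => ⟨j, hj, hz⟩
  exact key.mono fun a ha => isRigid_of_sphere ha

/-! ### Rigid forms have maximal rank -/

lemma nodalForm_apply (d m : ℕ) (a : (Fin m → ℝ) × (Fin m → ℝ)) (j : Fin (d + 1)) :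
    nodalForm d m a j = d.choose j * ∑ i, a.1 i * a.2 i ^ (j : ℕ) := by
  simp only [nodalForm, Finset.sum_apply, Pi.smul_apply, powVec, smul_eq_mul, one_pow, mul_one,
    Finset.mul_sum]
  exact Finset.sum_congr rfl fun i _ => by ring

lemma nodalPairing_eq_of_nodalForm_eq {d m r : ℕ} {c x : Fin m → ℝ} {e : Fin r → ℝ}
    {L : Fin r → ℝ × ℝ} (h : nodalForm d m (c, x) = ∑ i, e i • powVec d (L i)) {s : ℕ}
    (w : Fin s → ℝ × ℝ) {j : ℕ} (hj : j + s ≤ d) :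
    nodalPairing c x w j = ∑ i, e i * (L i).1 ^ j * (L i).2 ^ (d - j - s) *
      ∏ k, ((w k).1 * (L i).1 - (w k).2 * (L i).2) := by
  induction s generalizing j with
  | zero =>
    have hc : (d.choose j : ℝ) ≠ 0 := by exact_mod_cast (Nat.choose_pos (by omega)).ne'
    have := congrFun h ⟨j, by omega⟩
    rw [nodalForm_apply] at this
    simp only [Finset.sum_apply, Pi.smul_apply, powVec, smul_eq_mul] at this
    apply mul_left_cancel₀ hc
    simp only [nodalPairing, Finset.univ_eq_empty, Finset.prod_empty, mul_one, this,
      Finset.mul_sum, Nat.sub_zero]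
    exact Finset.sum_congr rfl fun i _ => by ring
  | succ s ih =>
    have h1 := ih (Fin.tail w) (j := j + 1) (by omega)
    have h2 := ih (Fin.tail w) (j := j) (by omega)
    have e1 : nodalPairing c x w j = (w 0).1 * nodalPairing c x (Fin.tail w) (j + 1) -
        (w 0).2 * nodalPairing c x (Fin.tail w) j := by
      simp only [nodalPairing, Finset.mul_sum, ← Finset.sum_sub_distrib, Fin.prod_univ_succ,
        Fin.tail]
      exact Finset.sum_congr rfl fun i _ => by ring
    rw [e1, h1, h2, Finset.mul_sum, Finset.mul_sum, ← Finset.sum_sub_distrib]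
    refine Finset.sum_congr rfl fun i _ => ?_
    rw [Fin.prod_univ_succ, show d - (j + 1) - s = d - j - (s + 1) by omega,
      show d - j - s = d - j - (s + 1) + 1 by omega]
    simp only [Fin.tail]
    ring

lemma IsRigid.rsr_eq {d n : ℕ} {c x : Fin (n + 1) → ℝ} (h : IsRigid d n c x) :
    Rsr d (nodalForm d (n + 1) (c, x)) = n + 1 := by
  have hmem : n + 1 ∈ {r : ℕ | ∃ (e : Fin r → ℝ) (L : Fin r → ℝ × ℝ),
      nodalForm d (n + 1) (c, x) = ∑ i, e i • powVec d (L i)} :=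
    ⟨c, fun i => (x i, 1), rfl⟩
  refine le_antisymm (Nat.sInf_le hmem) (le_csInf ⟨_, hmem⟩ ?_)
  rintro r ⟨e, L, hL⟩
  by_contra! hr
  let w : Fin n → ℝ × ℝ := fun k =>
    if hk : (k : ℕ) < r then if L ⟨k, hk⟩ = 0 then (1, 0) else ((L ⟨k, hk⟩).2, (L ⟨k, hk⟩).1)
    else (1, 0)
  have hw : ∀ k, w k ≠ 0 := by
    intro k
    simp only [w]
    split_ifs with h1 h2
    · simp
    · contrapose! h2
      simp only [Prod.mk_eq_zero] at h2
      exact Prod.ext h2.2 h2.1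
    · simp
  obtain ⟨j, hj, hne⟩ := h w hw
  refine hne ?_
  rw [nodalPairing_eq_of_nodalForm_eq hL w hj]
  refine Finset.sum_eq_zero fun i _ => mul_eq_zero_of_right _ ?_
  refine Finset.prod_eq_zero (Finset.mem_univ ⟨i, by omega⟩) ?_
  simp only [w, i.isLt, dite_true, Fin.eta]
  split_ifs with h0
  · simp [h0]
  · ring

lemma IsRigid.coeff_ne_zero_and_node_ne {d n : ℕ} {c x : Fin (n + 1) → ℝ} (h : IsRigid d n c x)
    (k : Fin (n + 1)) : c k ≠ 0 ∧ ∀ l, l ≠ k → x l ≠ x k := by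
  obtain ⟨j, -, hne⟩ := h (fun l => (1, x (k.succAbove l))) fun l => by simp
  have hz : nodalPairing c x (fun l => (1, x (k.succAbove l))) j =
      c k * x k ^ j * ∏ l, (1 * x k - x (k.succAbove l)) := by
    refine Finset.sum_eq_single_of_mem k (Finset.mem_univ k) fun i _ hi => ?_
    obtain ⟨l, rfl⟩ := Fin.exists_succAbove_eq hi
    exact mul_eq_zero_of_right _ (Finset.prod_eq_zero (Finset.mem_univ l) (by simp))
  rw [hz] at hne
  refine ⟨left_ne_zero_of_mul (left_ne_zero_of_mul hne), fun l hl hlk => ?_⟩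
  obtain ⟨i, rfl⟩ := Fin.exists_succAbove_eq hl
  exact right_ne_zero_of_mul hne (Finset.prod_eq_zero (Finset.mem_univ i) (by simp [hlk]))

/-! ### The rank is locally bounded above -/

/-- The derivative of `nodalForm d m` at `a`. -/
noncomputable def nodalFormDeriv (d m : ℕ) (a : (Fin m → ℝ) × (Fin m → ℝ)) :
    ((Fin m → ℝ) × (Fin m → ℝ)) →L[ℝ] (Fin (d + 1) → ℝ) :=
  LinearMap.toContinuousLinearMap
    { toFun := fun b j => d.choose j *
        ∑ i, (b.1 i * a.2 i ^ (j : ℕ) + a.1 i * (j * a.2 i ^ ((j : ℕ) - 1) * b.2 i))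
      map_add' := fun b b' => by
        ext j
        simp only [Prod.fst_add, Prod.snd_add, Pi.add_apply, ← mul_add, ← Finset.sum_add_distrib]
        congr 1
        exact Finset.sum_congr rfl fun i _ => by ring
      map_smul' := fun t b => by
        ext j
        simp only [Prod.smul_fst, Prod.smul_snd, Pi.smul_apply, smul_eq_mul, RingHom.id_apply,
          Finset.mul_sum]
        exact Finset.sum_congr rfl fun i _ => by ring }

lemma nodalFormDeriv_apply (d m : ℕ) (a b : (Fin m → ℝ) × (Fin m → ℝ)) (j : Fin (d + 1)) :
    nodalFormDeriv d m a b j = d.choose j *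
      ∑ i, (b.1 i * a.2 i ^ (j : ℕ) + a.1 i * (j * a.2 i ^ ((j : ℕ) - 1) * b.2 i)) := rfl

lemma hasStrictFDerivAt_nodalForm (d m : ℕ) (a : (Fin m → ℝ) × (Fin m → ℝ)) :
    HasStrictFDerivAt (nodalForm d m) (nodalFormDeriv d m a) a := by
  rw [hasStrictFDerivAt_pi']
  intro j
  have hc (i : Fin m) : HasStrictFDerivAt (fun b : (Fin m → ℝ) × (Fin m → ℝ) => b.1 i) _ a :=
    (hasStrictFDerivAt_apply (𝕜 := ℝ) (F' := fun _ : Fin m => ℝ) i a.1).comp a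
      hasStrictFDerivAt_fst
  have hx (i : Fin m) : HasStrictFDerivAt (fun b : (Fin m → ℝ) × (Fin m → ℝ) => b.2 i) _ a :=
    (hasStrictFDerivAt_apply (𝕜 := ℝ) (F' := fun _ : Fin m => ℝ) i a.2).comp a
      hasStrictFDerivAt_snd
  have key := (HasStrictFDerivAt.fun_sum (u := Finset.univ) fun i _ =>
    (hc i).mul ((hx i).pow (j : ℕ))).const_mul (d.choose j : ℝ)
  simp only [nodalForm_apply]
  refine key.congr_fderiv (ContinuousLinearMap.ext fun b => ?_)
  simp only [smul_apply, sum_apply, add_apply,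
    ContinuousLinearMap.comp_apply, ContinuousLinearMap.proj_apply,
    ContinuousLinearMap.coe_fst', ContinuousLinearMap.coe_snd', nodalFormDeriv_apply, smul_eq_mul,
    nsmul_eq_mul]
  congr 1
  exact Finset.sum_congr rfl fun i _ => by ring

lemma eq_zero_of_double_roots_s15 {m : ℕ} {x : Fin m → ℝ} (hx : Function.Injective x) {p : ℝ[X]}
    (h0 : ∀ i, p.eval (x i) = 0) (h1 : ∀ i, p.derivative.eval (x i) = 0)
    (hp : p.natDegree < 2 * m) : p = 0 := by
  by_contra hne
  have hdvd : ∏ i, (X - C (x i)) ^ 2 ∣ p := by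
    refine Finset.prod_dvd_of_coprime (fun i _ k _ hik => ?_) fun i _ => ?_
    · exact (isCoprime_X_sub_C_of_isUnit_sub
        (isUnit_iff_ne_zero.2 (sub_ne_zero.2 (hx.ne hik)))).pow
    · rw [← le_rootMultiplicity_iff hne]
      exact (one_lt_rootMultiplicity_iff_isRoot hne).2 ⟨h0 i, h1 i⟩
  have := natDegree_le_of_dvd hdvd hne
  rw [natDegree_prod_of_monic _ _ fun i _ => (monic_X_sub_C _).pow 2] at this
  simp only [natDegree_pow, natDegree_X_sub_C, Finset.sum_const, Finset.card_univ,
    Fintype.card_fin, smul_eq_mul] at this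
  omega

lemma range_nodalFormDeriv_eq_top {d m : ℕ} {c x : Fin m → ℝ} (hc : ∀ i, c i ≠ 0)
    (hx : Function.Injective x) (hdm : d < 2 * m) :
    (nodalFormDeriv d m (c, x)).range = ⊤ := by
  by_contra hlt
  obtain ⟨φ, hφ, hle⟩ := Submodule.exists_le_ker_of_lt_top _ (lt_top_iff_ne_top.2 hlt)
  let y : Fin (d + 1) → ℝ := fun j => φ (Pi.single j 1) * d.choose j
  let p : ℝ[X] := ∑ j : Fin (d + 1), C (y j) * X ^ (j : ℕ)
  have hsum (v : Fin (d + 1) → ℝ) : φ v = ∑ j, v j * φ (Pi.single j 1) := by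
    rw [LinearMap.pi_apply_eq_sum_univ φ v]
    refine Finset.sum_congr rfl fun j _ => ?_
    rw [smul_eq_mul]
    congr 2
    ext k
    simp [Pi.single_apply, eq_comm]
  have hker (b : (Fin m → ℝ) × (Fin m → ℝ)) : φ (nodalFormDeriv d m (c, x) b) = 0 :=
    hle ⟨b, rfl⟩
  have h0 (i : Fin m) : p.eval (x i) = 0 := by
    rw [← hker (Pi.single i 1, 0), hsum]
    simp only [p, eval_finsetSum, nodalFormDeriv_apply]
    refine Finset.sum_congr rfl fun j _ => ?_
    simp [Pi.single_apply, y]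
    ring
  have h1 (i : Fin m) : p.derivative.eval (x i) = 0 := by
    apply (mul_eq_zero.1 (_ : c i * _ = 0)).resolve_left (hc i)
    rw [← hker (0, Pi.single i 1), hsum]
    simp only [p, derivative_sum, eval_finsetSum, nodalFormDeriv_apply, Finset.mul_sum]
    refine Finset.sum_congr rfl fun j _ => ?_
    simp [Pi.single_apply, y, derivative_X_pow]
    ring
  have hdeg : p.natDegree ≤ d :=
    natDegree_sum_le_of_forall_le _ _ fun j _ =>
      (natDegree_C_mul_X_pow_le _ _).trans (Nat.lt_succ_iff.1 j.isLt)
  have hp : p = 0 := eq_zero_of_double_roots_s15 hx h0 h1 (by omega)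
  refine hφ (LinearMap.ext fun v => ?_)
  rw [hsum]
  refine Finset.sum_eq_zero fun j _ => mul_eq_zero_of_right _ ?_
  have hj : p.coeff j = y j := by
    simp [p, coeff_C_mul, coeff_X_pow, Fin.val_inj]
  rw [hp, coeff_zero] at hj
  have hchoose : (d.choose j : ℝ) ≠ 0 := by
    exact_mod_cast (Nat.choose_pos (Nat.lt_succ_iff.1 j.isLt)).ne'
  exact (mul_eq_zero.1 hj.symm).resolve_right hchoose

lemma IsRigid.isTypicalRank {d n : ℕ} {c x : Fin (n + 1) → ℝ} (h : IsRigid d n c x)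
    (hdn : d ≤ 2 * n + 1) : IsTypicalRank d (n + 1) := by
  have hsurj := range_nodalFormDeriv_eq_top (d := d) (fun k => (h.coeff_ne_zero_and_node_ne k).1)
    (fun i k hik => by_contra fun hne => (h.coeff_ne_zero_and_node_ne k).2 i hne hik) (by omega)
  have hmem : nodalForm d (n + 1) '' {a | IsRigid d n a.1 a.2} ∈
      𝓝 (nodalForm d (n + 1) (c, x)) := by
    rw [← (hasStrictFDerivAt_nodalForm d (n + 1) (c, x)).map_nhds_eq_of_surj hsurj]
    exact Filter.image_mem_map h.eventually
  refine ⟨_, isOpen_interior, ⟨_, mem_interior_iff_mem_nhds.2 hmem⟩, fun f hf => ?_⟩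
  obtain ⟨a, ha, rfl⟩ := interior_subset hf
  exact IsRigid.rsr_eq ha

/-! ### Construction of rigid forms -/

lemma exists_nodes_re_eval_I (n : ℕ) : ∃ (γ : ℂ) (c x : Fin (n + 1) → ℝ), γ ≠ 0 ∧
    ∀ q : ℝ[X], q.natDegree ≤ n + 1 →
      ∑ i, c i * q.eval (x i) = (γ * aeval Complex.I q).re := by
  let x : Fin (n + 1) → ℝ := fun i => i
  have hx : Function.Injective x := fun i k h => Fin.ext (Nat.cast_injective (R := ℝ) h)
  let P : ℝ[X] := ∏ i, (X - C (x i))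
  have hPm : P.Monic := monic_prod_of_monic _ _ fun i _ => monic_X_sub_C _
  have hPd : P.natDegree = n + 1 := by
    rw [natDegree_prod_of_monic _ _ fun i _ => monic_X_sub_C _]
    simp
  have hPI : aeval Complex.I P ≠ 0 := by
    simp only [P, map_prod, Finset.prod_ne_zero_iff]
    intro i _ hi
    simpa using congrArg Complex.im hi
  let γ : ℂ := Complex.I * (starRingEnd ℂ) (aeval Complex.I P)
  let ℓ : ℝ[X] →ₗ[ℝ] ℝ :=
    Complex.reLm ∘ₗ LinearMap.mulLeft ℝ γ ∘ₗ (aeval Complex.I : ℝ[X] →ₐ[ℝ] ℂ).toLinearMap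
  have hℓ (q : ℝ[X]) : ℓ q = (γ * aeval Complex.I q).re := rfl
  have hℓP : ℓ P = 0 := by
    rw [hℓ, mul_assoc, mul_comm ((starRingEnd ℂ) _), Complex.mul_conj]
    simp
  refine ⟨γ, fun i => ℓ (Lagrange.basis Finset.univ x i), x,
    mul_ne_zero Complex.I_ne_zero ((_root_.map_ne_zero _).2 hPI), fun q hq => ?_⟩
  have hPx (i : Fin (n + 1)) : P.eval (x i) = 0 := by
    rw [eval_prod]
    exact Finset.prod_eq_zero (Finset.mem_univ i) (by simp)
  have hr : (q %ₘ P).degree < (Finset.univ : Finset (Fin (n + 1))).card := by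
    have := degree_modByMonic_lt q hPm
    rwa [degree_eq_natDegree hPm.ne_zero, hPd, ← Fintype.card_fin (n + 1),
      ← Finset.card_univ] at this
  have hdiv : q /ₘ P = C ((q /ₘ P).coeff 0) := by
    apply eq_C_of_natDegree_eq_zero
    rw [natDegree_divByMonic _ hPm, hPd]
    omega
  have hq' : q %ₘ P + (q /ₘ P).coeff 0 • P = q := by
    rw [smul_eq_C_mul, ← hdiv, mul_comm]
    exact modByMonic_add_div q P
  have hev (i : Fin (n + 1)) : q.eval (x i) = (q %ₘ P).eval (x i) := by
    conv_lhs => rw [← hq']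
    simp [hPx]
  rw [← hℓ, ← hq', map_add, map_smul, hℓP, smul_zero, add_zero, hq',
    Lagrange.eq_interpolate_of_eval_eq (fun i => q.eval (x i)) hx.injOn hr
      (fun i _ => (hev i).symm), Lagrange.interpolate_apply, map_sum]
  refine Finset.sum_congr rfl fun i _ => ?_
  rw [← smul_eq_C_mul, map_smul, smul_eq_mul, mul_comm]

lemma exists_isRigid_succ_self (n : ℕ) : ∃ c x : Fin (n + 1) → ℝ, IsRigid (n + 1) n c x := by
  obtain ⟨γ, c, x, hγ, h⟩ := exists_nodes_re_eval_I n
  refine ⟨c, x, fun w hw => ?_⟩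
  let g : ℝ[X] := ∏ k, (C (w k).1 * X - C (w k).2)
  have hgd : g.natDegree ≤ n := by
    refine (natDegree_prod_le _ _).trans ((Finset.sum_le_card_nsmul _ _ 1 fun k _ => ?_).trans
      (by simp))
    compute_degree
  have hgI : aeval Complex.I g ≠ 0 := by
    simp only [g, map_prod, Finset.prod_ne_zero_iff]
    intro k _ hk
    apply hw k
    have h1 := congrArg Complex.im hk
    have h2 := congrArg Complex.re hk
    simp at h1 h2
    exact Prod.ext h1 h2
  have hpair (j : ℕ) (hj : j + n ≤ n + 1) :
      nodalPairing c x w j = (γ * aeval Complex.I g * Complex.I ^ j).re := by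
    have hdeg : (X ^ j * g).natDegree ≤ n + 1 :=
      natDegree_mul_le.trans (by rw [natDegree_X_pow]; omega)
    have := h (X ^ j * g) hdeg
    rw [map_mul, map_pow, aeval_X, mul_comm (Complex.I ^ j), ← mul_assoc] at this
    rw [← this]
    refine Finset.sum_congr rfl fun i _ => ?_
    simp [g, eval_prod, mul_assoc]
  by_contra! hcon
  have h0 := hpair 0 (by omega)
  have h1 := hpair 1 (by omega)
  rw [hcon 0 (by omega)] at h0
  rw [hcon 1 (by omega)] at h1
  simp only [pow_zero, mul_one, pow_one, Complex.mul_I_re] at h0 h1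
  exact mul_ne_zero hγ hgI (Complex.ext h0.symm (neg_eq_zero.1 h1.symm))

lemma IsRigid.exists_add_two {d n : ℕ} {c x : Fin (n + 1) → ℝ} (h : IsRigid d n c x) :
    ∃ c' x' : Fin (n + 2) → ℝ, IsRigid (d + 2) (n + 1) c' x' := by
  obtain ⟨z, hz⟩ := (Set.finite_range x).exists_notMem
  have hxz (i : Fin (n + 1)) : x i - z ≠ 0 := sub_ne_zero.2 fun hi => hz ⟨i, hi⟩
  let G (w : Fin (n + 1) → ℝ × ℝ) (t : ℝ) : ℝ := ∏ k, ((w k).1 * t - (w k).2)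
  let b : Fin (n + 1) → ℝ := fun i => c i / (x i - z) ^ 2
  let A (ε : ℝ) (w : Fin (n + 1) → ℝ × ℝ) : ℝ := G w z + ε * nodalPairing b x w 0
  let B (w : Fin (n + 1) → ℝ × ℝ) (j : ℕ) : ℝ :=
    nodalPairing (fun i => c i / (x i - z)) x w j
  have hev : ∀ᶠ ε in 𝓝 (0 : ℝ),
      ∀ w ∈ Set.univ.pi fun _ : Fin (n + 1) => Metric.sphere (0 : ℝ × ℝ) 1,
        A ε w ≠ 0 ∨ ∃ j, j + n ≤ d ∧ B w j ≠ 0 := by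
    refine (isCompact_spheres (n + 1)).eventually_forall_of_forall_eventually fun w hw => ?_
    by_cases hA : G w z = 0
    · obtain ⟨k, -, hk⟩ := Finset.prod_eq_zero_iff.1 hA
      have hne (l : Fin (n + 1)) : w l ≠ 0 := ne_zero_of_mem_spheres hw l
      have hu : (w k).1 ≠ 0 := fun hu => hne k (Prod.ext hu (by simpa [hu] using hk))
      obtain ⟨j, hj, hpair⟩ := h (fun l => w (k.succAbove l)) fun l => hne _
      have hB : B w j = (w k).1 * nodalPairing c x (fun l => w (k.succAbove l)) j := by
        simp only [B, nodalPairing, Finset.mul_sum]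
        refine Finset.sum_congr rfl fun i _ => ?_
        rw [Fin.prod_univ_succAbove _ k,
          show (w k).1 * x i - (w k).2 = (w k).1 * (x i - z) by linear_combination hk]
        field_simp [hxz i]
      have hBc : Continuous fun a : ℝ × (Fin (n + 1) → ℝ × ℝ) => B a.2 j := by
        simp only [B, nodalPairing]
        fun_prop
      have hB0 : B w j ≠ 0 := hB ▸ mul_ne_zero hu hpair
      exact (hBc.continuousAt.eventually_ne (x := ((0 : ℝ), w)) hB0).mono
        fun a ha => Or.inr ⟨j, hj, ha⟩
    · have hAc : Continuous fun a : ℝ × (Fin (n + 1) → ℝ × ℝ) => A a.1 a.2 := by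
        simp only [A, G, nodalPairing]
        fun_prop
      have hA0 : A 0 w ≠ 0 := by simpa [A] using hA
      exact (hAc.continuousAt.eventually_ne (x := ((0 : ℝ), w)) hA0).mono fun a ha => Or.inl ha
  obtain ⟨ε, hε, hεpos⟩ :=
    ((hev.filter_mono nhdsWithin_le_nhds).and (self_mem_nhdsWithin (s := Set.Ioi 0))).exists
  have hε0 : ε ≠ 0 := hεpos.ne'
  refine ⟨Fin.cons ε⁻¹ b, Fin.cons z x, isRigid_of_sphere fun w hw => ?_⟩
  have hexp (j : ℕ) : nodalPairing (Fin.cons ε⁻¹ b : Fin (n + 2) → ℝ) (Fin.cons z x) w j =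
      ε⁻¹ * z ^ j * G w z + nodalPairing b x w j := by
    simp [nodalPairing, Fin.sum_univ_succ, G]
  by_contra! hcon
  rcases hε w hw with hA | ⟨j, hj, hB⟩
  · apply hA
    have hnd : n ≤ d := by
      obtain ⟨j, hj, -⟩ := h (fun _ => (1, 0)) fun _ => by simp
      omega
    have h0 := hcon 0 (by omega)
    rw [hexp] at h0
    simp only [A]
    field_simp at h0
    linear_combination h0
  · apply hB
    have h0 := hcon j (by omega)
    have h1 := hcon (j + 1) (by omega)
    rw [hexp] at h0 h1
    have hdiff : B w j = nodalPairing b x w (j + 1) - z * nodalPairing b x w j := by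
      simp only [B, nodalPairing, Finset.mul_sum, ← Finset.sum_sub_distrib, b]
      refine Finset.sum_congr rfl fun i _ => ?_
      have := hxz i
      field_simp
      ring
    rw [hdiff]
    linear_combination h1 - z * h0

lemma exists_isRigid (n k : ℕ) :
    ∃ c x : Fin (n + k + 1) → ℝ, IsRigid (n + 1 + 2 * k) (n + k) c x := by
  induction k with
  | zero => exact exists_isRigid_succ_self n
  | succ k ih =>
    obtain ⟨c, x, h⟩ := ih
    exact h.exists_add_two

lemma isTypicalRank_sub {d k : ℕ} (hk : 2 * k + 1 ≤ d) : IsTypicalRank d (d - k) := by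
  obtain ⟨n, rfl⟩ := Nat.exists_eq_add_of_le hk
  obtain ⟨c, x, h⟩ := exists_isRigid n k
  convert h.isTypicalRank (by omega) using 1 <;> omega

lemma exists_finset_typicalRanks {d k : ℕ} (hk : 2 * k ≤ d + 1) :
    ∃ S : Finset ℕ, k ≤ S.card ∧ ∀ t ∈ S, IsTypicalRank d t := by
  refine ⟨(Finset.range k).image (d - ·), ?_, fun t ht => ?_⟩
  · rw [Finset.card_image_of_injOn, Finset.card_range]
    intro a ha b hb hab
    simp only [Finset.coe_range, Set.mem_Iio] at ha hb hab
    omega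
  · obtain ⟨i, hi, rfl⟩ := Finset.mem_image.1 ht
    exact isTypicalRank_sub (by have := Finset.mem_range.1 hi; omega)

/-- For every even `d ≥ 6` there are at least `3` distinct typical ranks, and
for every odd `d ≥ 7` there are at least `4` distinct typical ranks for real
binary forms of degree `d`. -/
theorem many_typical_ranks :
    (∀ d : ℕ, Even d → 6 ≤ d →
        ∃ S : Finset ℕ, 3 ≤ S.card ∧ ∀ t ∈ S, IsTypicalRank d t) ∧
      (∀ d : ℕ, Odd d → 7 ≤ d →
        ∃ S : Finset ℕ, 4 ≤ S.card ∧ ∀ t ∈ S, IsTypicalRank d t) := by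
  exact ⟨fun d _ hd => exists_finset_typicalRanks (by omega),
    fun d _ hd => exists_finset_typicalRanks (by omega)⟩
end
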